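/- arXiv:2210.16714 — 2 statements merged into one kernel-verified Lean document; each statement's English description precedes it below -/
import Mathlib

section
/- If a reflexive graph G does not contain an invertible pair, then G is a strong cocomparability graph, i.e., G admits a strong cocomparability ordering. -/
/-- The strong cocomparability (Slash-free) ordering condition. -/
def IsSCOrdering {V : Type*} (E : V → V → Prop) (lt : V → V → Prop) : Prop :=
  ∀ u v x y : V, lt u v → lt x y → ¬(¬ E u x ∧ E u y ∧ E v x ∧ ¬ E v y)

/-- A strong cocomparability graph. -/
def IsStrongCocompGraph {V : Type*} (E : V → V → Prop) : Prop :=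
  ∃ lt : V → V → Prop, IsStrictTotalOrder V lt ∧ IsSCOrdering E lt

/-- The forcing relation Λ on ordered pairs of vertices. -/
def Forces {V : Type*} (E : V → V → Prop) (p q : V × V) : Prop :=
  p = q ∨ (E p.1 q.1 ∧ E p.2 q.2 ∧ ¬ E p.1 q.2 ∧ ¬ E p.2 q.1)

/-- The implication relation ~ generated by Λ. -/
def SimPair {V : Type*} (E : V → V → Prop) : V × V → V × V → Prop :=
  Relation.ReflTransGen (Forces E)

section Orientation

variable {V : Type*} {F : V → V → Prop} {T₀ T₁ : V → V → Prop}

/-- A symmetric relation `F`, read as a bipartite relation between two copies of `V` (rows and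
columns), with asymmetric relations `T₀` on rows and `T₁` on columns that are compatible with
every `2 × 2` identity submatrix of `F`. -/
structure Compat (F T₀ T₁ : V → V → Prop) : Prop where
  symm : ∀ {u v}, F u v → F v u
  row_col : ∀ {u v u' v'}, F u u' → F v v' → ¬ F u v' → ¬ F v u' → T₀ u v → T₁ u' v'
  col_row : ∀ {u v u' v'}, F u u' → F v v' → ¬ F u v' → ¬ F v u' → T₁ u v → T₀ u' v'
  asymm_row : ∀ {u v}, T₀ u v → ¬ T₀ v u
  asymm_col : ∀ {u v}, T₁ u v → ¬ T₁ v u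

/-- Three rows, cyclically oriented by `T`, and three columns which induce an identity matrix. -/
structure Triangle (F T : V → V → Prop) (x y z x' y' z' : V) : Prop where
  xx : F x x'
  yy : F y y'
  zz : F z z'
  xy : ¬ F x y'
  xz : ¬ F x z'
  yx : ¬ F y x'
  yz : ¬ F y z'
  zx : ¬ F z x'
  zy : ¬ F z y'
  txy : T x y
  tyz : T y z
  tzx : T z x

theorem Compat.flip (h : Compat F T₀ T₁) : Compat F T₁ T₀ :=
  ⟨h.symm, h.col_row, h.row_col, h.asymm_col, h.asymm_row⟩

namespace Triangle

variable {x y z x' y' z' c : V}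

theorem rotate (t : Triangle F T₀ x y z x' y' z') : Triangle F T₀ y z x y' z' x' :=
  ⟨t.yy, t.zz, t.xx, t.yz, t.yx, t.zy, t.zx, t.xy, t.xz, t.tyz, t.tzx, t.txy⟩

theorem flip (h : Compat F T₀ T₁) (t : Triangle F T₀ x y z x' y' z') :
    Triangle F T₁ x' y' z' x y z :=
  ⟨h.symm t.xx, h.symm t.yy, h.symm t.zz, fun e => t.yx (h.symm e), fun e => t.zx (h.symm e),
    fun e => t.xy (h.symm e), fun e => t.zy (h.symm e), fun e => t.xz (h.symm e),
    fun e => t.yz (h.symm e), h.row_col t.xx t.yy t.xy t.yx t.txy,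
    h.row_col t.yy t.zz t.yz t.zy t.tyz, h.row_col t.zz t.xx t.zx t.xz t.tzx⟩

/-- No column has exactly two ones on the rows of a triangle. -/
theorem column_full (h : Compat F T₀ T₁) (t : Triangle F T₀ x y z x' y' z')
    (hx : F c x) (hy : F c y) : F c z := by
  by_contra hz
  have hz' : ¬ F z c := fun e => hz (h.symm e)
  exact h.asymm_col (h.row_col t.zz (h.symm hx) hz' t.xz t.tzx)
    (h.row_col (h.symm hy) t.zz t.yz hz' t.tyz)

theorem replace_col (h : Compat F T₀ T₁) (t : Triangle F T₀ x y z x' y' z')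
    (hx : F c x) (hy : ¬ F c y) : Triangle F T₀ x y z c y' z' :=
  { t with
    xx := h.symm hx
    yx := fun e => hy (h.symm e)
    zx := fun e => hy (t.rotate.rotate.column_full h (h.symm e) hx) }

theorem replace_row (h : Compat F T₀ T₁) (t : Triangle F T₀ x y z x' y' z')
    (hx : F c x') (hy : ¬ F c y') : Triangle F T₀ c y z x' y' z' :=
  ((t.flip h).replace_col h.flip hx hy).flip h.flip

end Triangle

/-- The pair of rows `(p, q)` is obtained from a triangle with rows `y`, `z` in the second and
third place by moving its third and first row. -/
def Moved (F T : V → V → Prop) (y z y' z' p q : V) : Prop :=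
  (∃ p' q', Triangle F T q y p q' y' p') ∧ ∃ x', Triangle F T q y z x' y' z'

theorem Moved.step (h : Compat F T₀ T₁) {y z y' z' p q p' q' : V}
    (hm : Moved F T₀ y z y' z' p q) (hp : F p p') (hq : F q q') (hpq : ¬ F p q')
    (hqp : ¬ F q p') : Moved F T₁ y' z' y z p' q' := by
  obtain ⟨⟨p₁, q₁, t⟩, x₁, s⟩ := hm
  have hy : ¬ F q' y := fun e => hpq (h.symm (t.column_full h (h.symm hq) e))
  have t₁ := t.replace_col h (h.symm hq) hy
  have t₂ := (t₁.rotate.rotate.replace_col h (h.symm hp) (fun e => hqp (h.symm e))).rotate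
  exact ⟨⟨_, _, t₂.flip h⟩, _, (s.replace_col h (h.symm hq) hy).flip h⟩

end Orientation

section Parity

variable {V : Type*} {F : V → V → Prop} {U U' : Set V}

/-- A step of a walk in `F` avoiding `U`, in the bipartite double cover. -/
def AvoidStep (F : V → V → Prop) (U : Set V) (p q : V × Bool) : Prop :=
  F p.1 q.1 ∧ p.1 ∉ U ∧ q.1 ∉ U ∧ q.2 = !p.2

/-- Walks in `F` avoiding `U`, with parity. -/
def AvoidWalk (F : V → V → Prop) (U : Set V) : V × Bool → V × Bool → Prop :=
  Relation.ReflTransGen (AvoidStep F U)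

/-- The vertices reached from `a` by a walk avoiding `U`. -/
def component (F : V → V → Prop) (U : Set V) (a : V) : Set V :=
  {b | ∃ i, AvoidWalk F U (a, false) (b, i)}

/-- `a` lies on a closed odd walk avoiding `U`, and `U` is complete to the component of `a`. -/
def IsOddCore (F : V → V → Prop) (a : V) (U : Set V) : Prop :=
  AvoidWalk F U (a, false) (a, true) ∧ ∀ u ∈ U, ∀ x ∈ component F U a, F u x

theorem AvoidWalk.symm (hF : ∀ {u v}, F u v → F v u) {p q : V × Bool}
    (w : AvoidWalk F U p q) : AvoidWalk F U q p := by
  induction w with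
  | refl => exact .refl
  | tail _ h ih => exact ih.head ⟨hF h.1, h.2.2.1, h.2.1, by simp [h.2.2.2]⟩

theorem AvoidWalk.not {p q : V × Bool} (w : AvoidWalk F U p q) :
    AvoidWalk F U (p.1, !p.2) (q.1, !q.2) := by
  induction w with
  | refl => exact .refl
  | tail _ h ih => exact ih.tail ⟨h.1, h.2.1, h.2.2.1, by simp [h.2.2.2]⟩

theorem AvoidWalk.notMem {p q : V × Bool} (w : AvoidWalk F U p q) (hp : p.1 ∉ U) : q.1 ∉ U := by
  induction w with
  | refl => exact hp
  | tail _ h _ => exact h.2.2.1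

theorem notMem_of_odd {a : V} (w : AvoidWalk F U (a, false) (a, true)) : a ∉ U := by
  rcases Relation.ReflTransGen.cases_tail w with h | ⟨b, _, h⟩
  · simp at h
  · exact h.2.2.1

theorem odd_of_mem_component (hF : ∀ {u v}, F u v → F v u) {a b : V}
    (w : AvoidWalk F U (a, false) (a, true)) (hb : b ∈ component F U a) :
    AvoidWalk F U (b, false) (b, true) := by
  obtain ⟨i, hi⟩ := hb
  have hw : AvoidWalk F U (b, i) (b, !i) := ((hi.symm hF).trans w).trans hi.not
  cases i
  · exact hw
  · exact hw.not

theorem mem_component_of_step {a b c : V} (ha : a ∉ U) (hb : b ∈ component F U a)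
    (hbc : F b c) (hc : c ∉ U) : c ∈ component F U a := by
  obtain ⟨i, hi⟩ := hb
  exact ⟨!i, hi.tail ⟨hbc, hi.notMem ha, hc, rfl⟩⟩

theorem mem_component_self (a : V) : a ∈ component F U a := ⟨false, .refl⟩

theorem AvoidWalk.change {a b : V} {i : Bool}
    (hU : ∀ x ∈ component F U a, x ∉ U') (w : AvoidWalk F U (a, false) (b, i)) :
    AvoidWalk F U' (a, false) (b, i) := by
  have key : ∀ q, AvoidWalk F U (a, false) q → AvoidWalk F U' (a, false) q := by
    intro q w
    induction w with
    | refl => exact .refl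
    | @tail b c h₁ h₂ ih =>
      exact ih.tail ⟨h₂.1, hU _ ⟨_, h₁⟩, hU _ ⟨_, h₁.tail h₂⟩, h₂.2.2.2⟩
  exact key _ w

theorem IsOddCore.component_ssubset (hF : ∀ {u v}, F u v → F v u) {a b : V}
    (ha : IsOddCore F a U) (hbU : b ∉ U) (hb : ¬ AvoidWalk F U (b, false) (b, true))
    (hb' : IsOddCore F b U') : component F U a ⊂ component F U' b := by
  have haU := notMem_of_odd ha.1
  have hnb : b ∉ component F U a := fun e => hb (odd_of_mem_component hF ha.1 e)
  obtain ⟨u, hu, huU⟩ : ∃ u ∈ component F U' b, u ∈ U := by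
    by_contra! hcon
    exact hb (hb'.1.change hcon)
  refine (Set.ssubset_iff_of_subset fun x hx => ?_).2 ⟨b, mem_component_self b, hnb⟩
  refine mem_component_of_step (notMem_of_odd hb'.1) hu (ha.2 u huU x hx) fun hxU => ?_
  exact hnb (mem_component_of_step haU hx (hb'.2 x hxU b (mem_component_self b)) hbU)

/-- The least size of a component of an odd core at `a`. -/
noncomputable def coreRank (F : V → V → Prop) (a : V) : ℕ :=
  sInf ({Nat.card V + 1} ∪ {n | ∃ U, IsOddCore F a U ∧ n = (component F U a).ncard})

theorem coreRank_le (a : V) : coreRank F a ≤ Nat.card V + 1 :=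
  Nat.sInf_le (Or.inl rfl)

theorem IsOddCore.coreRank_lt [Finite V] (hF : ∀ {u v}, F u v → F v u) {a b : V}
    (ha : IsOddCore F a U) (hbU : b ∉ U) (hb : ¬ AvoidWalk F U (b, false) (b, true)) :
    coreRank F a < coreRank F b := by
  have h₁ : coreRank F a ≤ (component F U a).ncard := Nat.sInf_le (Or.inr ⟨U, ha, rfl⟩)
  refine h₁.trans_lt ?_
  have hmem : coreRank F b ∈
      ({Nat.card V + 1} ∪ {n | ∃ U, IsOddCore F b U ∧ n = (component F U b).ncard} : Set ℕ) :=
    Nat.sInf_mem ⟨_, Or.inl rfl⟩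
  rcases hmem with h | ⟨U', h, h'⟩
  · rw [Set.mem_singleton_iff.1 h]
    exact Nat.lt_succ_of_le (Set.ncard_le_card _)
  · rw [h']
    exact Set.ncard_lt_ncard (ha.component_ssubset hF hbU hb h) (Set.toFinite _)

theorem exists_key [Finite V] (F : V → V → Prop) :
    ∃ κ : V → ℕ, Function.Injective κ ∧ ∀ a b, coreRank F a < coreRank F b → κ b < κ a := by
  obtain ⟨n, ⟨e⟩⟩ := Finite.exists_equiv_fin V
  have key : ∀ a b, coreRank F a < coreRank F b →
      (Nat.card V + 1 - coreRank F b) * n + e b < (Nat.card V + 1 - coreRank F a) * n + e a := by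
    intro a b h
    have h₁ := coreRank_le (F := F) b
    have h₂ : Nat.card V + 1 - coreRank F b + 1 ≤ Nat.card V + 1 - coreRank F a := by omega
    have h₃ := Nat.mul_le_mul_right n h₂
    have h₄ := (e b).isLt
    rw [Nat.add_mul] at h₃
    omega
  refine ⟨fun v => (Nat.card V + 1 - coreRank F v) * n + e v, fun a b h => ?_, key⟩
  rcases lt_trichotomy (coreRank F a) (coreRank F b) with h' | h' | h'
  · exact absurd h (key a b h').ne'
  · have h : (Nat.card V + 1 - coreRank F a) * n + (e a : ℕ) =
      (Nat.card V + 1 - coreRank F b) * n + e b := h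
    rw [h'] at h
    exact e.injective (Fin.ext (by omega))
  · exact absurd h (key b a h').ne

end Parity

section OddCore

variable {V : Type*} {F : V → V → Prop} {T₀ T₁ : V → V → Prop} {m y z x x' y' z' : V}

/-- The common neighbours of four given vertices. -/
def commonNbrs (F : V → V → Prop) (y z y' z' : V) : Set V :=
  {u | F u y ∧ F u z ∧ F u y' ∧ F u z'}

theorem nbr_transfer (h : Compat F T₀ T₁) (hirr : ∀ v, ¬ F v v)
    (hT : ∀ {u v}, T₀ u v → ¬ T₁ u v) (t : Triangle F T₀ m y z x' y' z')
    (s : Triangle F T₀ x y z m y' z') {b : V} (hbm : F b m) (hby : F b y) : F b y' := by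
  by_contra hby'
  have hbz := t.column_full h hbm hby
  have s₁ := s.replace_row h hbm hby'
  have hzy : ¬ F z y := fun e => hirr z (s₁.column_full h (h.symm hbz) e)
  have s₂ := s₁.replace_col h (h.symm hbz) hzy
  have s₃ := (s₁.replace_col h (h.symm hby) (hirr y)).replace_row h (h.symm s₁.yy) (hirr y')
  exact hT s₃.tzx (s₂.flip h).txy

theorem component_subset (h : Compat F T₀ T₁) (hirr : ∀ v, ¬ F v v)
    (hT : ∀ {u v}, T₀ u v → ¬ T₁ u v) (t : Triangle F T₀ m y z x' y' z')
    (s : Triangle F T₀ x y z m y' z') {b : V}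
    (hb : b ∈ component F (commonNbrs F y z y' z') m) :
    (∃ c, Triangle F T₀ b y z c y' z') ∧ ∃ c, Triangle F T₀ c y z b y' z' := by
  obtain ⟨i, hi⟩ := hb
  have key : ∀ q, AvoidWalk F (commonNbrs F y z y' z') (m, false) q →
      (∃ c, Triangle F T₀ q.1 y z c y' z') ∧ ∃ c, Triangle F T₀ c y z q.1 y' z' := by
    intro q w
    induction w with
    | refl => exact ⟨⟨_, t⟩, ⟨_, s⟩⟩
    | @tail p q _ hstep ih =>
      obtain ⟨⟨c, tc⟩, ⟨d, td⟩⟩ := ih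
      obtain ⟨hpq, -, hq, -⟩ := hstep
      have hqp := h.symm hpq
      have h₁ : F q.1 y → F q.1 y' := nbr_transfer h hirr hT tc td hqp
      have h₂ : F q.1 y' → F q.1 y :=
        nbr_transfer h.flip hirr (fun e e' => hT e' e) (td.flip h) (tc.flip h) hqp
      have h₃ : ¬ F q.1 y := fun e =>
        hq ⟨e, tc.column_full h hqp e, h₁ e, (td.flip h).column_full h.flip hqp (h₁ e)⟩
      exact ⟨⟨_, td.replace_row h hqp fun e => h₃ (h₂ e)⟩, ⟨_, tc.replace_col h hqp h₃⟩⟩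
  exact key _ hi

theorem not_odd_third (h : Compat F T₀ T₁) (hirr : ∀ v, ¬ F v v)
    (hT : ∀ {u v}, T₀ u v → ¬ T₁ u v) (t : Triangle F T₀ m y z x' y' z')
    (s : Triangle F T₀ x y z m y' z') :
    ¬ AvoidWalk F (commonNbrs F y z y' z') (z, false) (z, true) := by
  have h₁ : ∀ {b}, F b m → F b y → F b y' := nbr_transfer h hirr hT t s
  have h₂ : ∀ {b}, F b m → F b y' → F b y :=
    nbr_transfer h.flip hirr (fun e e' => hT e' e) (s.flip h) (t.flip h)
  have key : ∀ q, AvoidWalk F (commonNbrs F y z y' z') (z, false) q →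
      (q.2 = false → ∃ c, Triangle F T₀ x y q.1 m y' c) ∧
      (q.2 = true → ∃ c, Triangle F T₀ x y c m y' q.1) := by
    intro q w
    induction w with
    | refl => exact ⟨fun _ => ⟨_, s⟩, fun e => by simp at e⟩
    | @tail p q _ hstep ih =>
      obtain ⟨hpq, -, hq, hpar⟩ := hstep
      have hqp := h.symm hpq
      refine ⟨fun e => ?_, fun e => ?_⟩
      · obtain ⟨c, tc⟩ := ih.2 (by simpa [e] using hpar)
        refine ⟨_, (tc.rotate.rotate.replace_row h hqp fun hqm => ?_).rotate⟩
        have hy' := (tc.flip h).rotate.rotate.column_full h.flip hqp hqm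
        have hy := h₂ hqm hy'
        exact hq ⟨hy, t.column_full h hqm hy, hy', (s.flip h).column_full h.flip hqm hy'⟩
      · obtain ⟨c, tc⟩ := ih.1 (by simpa [e] using hpar)
        refine ⟨_, (tc.rotate.rotate.replace_col h hqp fun hqx => ?_).rotate⟩
        have hy := tc.rotate.rotate.column_full h hqp hqx
        have hz := s.column_full h hqx hy
        have hqm := t.rotate.column_full h hy hz
        have hy' := h₁ hqm hy
        exact hq ⟨hy, hz, hy', (s.flip h).column_full h.flip hqm hy'⟩
  intro w
  obtain ⟨c, tc⟩ := (key _ w).2 rfl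
  exact hT t.tzx (tc.flip h).tzx

theorem isOddCore_of_triangles (h : Compat F T₀ T₁) (hirr : ∀ v, ¬ F v v)
    (hT : ∀ {u v}, T₀ u v → ¬ T₁ u v) (t : Triangle F T₀ m y z x' y' z')
    (s : Triangle F T₀ x y z m y' z')
    (w : AvoidWalk F (commonNbrs F y z y' z') (m, false) (m, true)) :
    IsOddCore F m (commonNbrs F y z y' z') := by
  refine ⟨w, fun u hu b hb => ?_⟩
  obtain ⟨⟨c, tc⟩, -⟩ := component_subset h hirr hT t s hb
  exact tc.rotate.column_full h hu.1 hu.2.1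

end OddCore

section Classes

variable {V : Type*} {E : V → V → Prop}

theorem Forces.swap {p q : V × V} (h : Forces E p q) : Forces E p.swap q.swap := by
  rcases h with rfl | ⟨h₁, h₂, h₃, h₄⟩
  · exact Or.inl rfl
  · exact Or.inr ⟨h₂, h₁, h₄, h₃⟩

theorem SimPair.swap {p q : V × V} (h : SimPair E p q) : SimPair E p.swap q.swap := by
  induction h with
  | refl => exact .refl
  | tail _ h ih => exact ih.tail h.swap

theorem SimPair.symm (hE : ∀ ⦃u v⦄, E u v → E v u) {p q : V × V} (h : SimPair E p q) : SimPair E q p := by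
  induction h with
  | refl => exact .refl
  | tail _ h ih =>
    refine ih.head ?_
    rcases h with rfl | ⟨h₁, h₂, h₃, h₄⟩
    · exact Or.inl rfl
    · exact Or.inr ⟨hE h₁, hE h₂, fun e => h₄ (hE e), fun e => h₃ (hE e)⟩

theorem SimPair.eq_of_subset {u v : V} (huv : ∀ w, E u w → E v w) {q : V × V}
    (h : SimPair E (u, v) q) : q = (u, v) := by
  induction h with
  | refl => rfl
  | tail _ h ih =>
    subst ih
    rcases h with h | ⟨h₁, -, -, h₄⟩
    · exact h.symm
    · exact absurd (huv _ h₁) h₄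

/-- The orientation choosing from each class and its reverse the one which contains the
lexicographically smallest pair. -/
theorem exists_orientation [Finite V] (hE : ∀ ⦃u v⦄, E u v → E v u)
    (h : ¬ ∃ u v : V, u ≠ v ∧ SimPair E (u, v) (v, u)) {κ : V → ℕ}
    (hκ : Function.Injective κ) :
    ∃ T : V → V → Prop,
      (∀ u v u' v', SimPair E (u, v) (u', v') → T u v → T u' v') ∧
      (∀ u v, T u v → ¬ T v u) ∧ (∀ u v, u ≠ v → T u v ∨ T v u) ∧
      (∀ u v, T u v → ∃ a b, SimPair E (u, v) (a, b) ∧ κ a ≤ κ v) ∧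
      ∀ u v, (∀ w, E u w ↔ E v w) → T u v → κ u < κ v := by
  obtain ⟨M, hM⟩ : ∃ M, ∀ v, κ v < M := by
    obtain ⟨B, hB⟩ := (Set.finite_range κ).bddAbove
    exact ⟨B + 1, fun v => Nat.lt_succ_of_le (hB ⟨v, rfl⟩)⟩
  have hlt : ∀ a b c d, κ a * M + κ b < κ c * M + κ d → κ a ≤ κ c := by
    intro a b c d hlt
    by_contra! hcon
    have h₁ := Nat.mul_le_mul_right M (Nat.succ_le_of_lt hcon)
    have h₂ := hM d
    rw [Nat.succ_mul] at h₁
    omega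
  have hinj : ∀ a b c d, κ a * M + κ b = κ c * M + κ d → a = c ∧ b = d := by
    intro a b c d he
    have hac : κ a = κ c := by
      have h₁ := hM b
      have h₂ := hM d
      rcases lt_trichotomy (κ a) (κ c) with hcon | hcon | hcon
      · have h₃ := Nat.mul_le_mul_right M (Nat.succ_le_of_lt hcon)
        rw [Nat.succ_mul] at h₃
        omega
      · exact hcon
      · have h₃ := Nat.mul_le_mul_right M (Nat.succ_le_of_lt hcon)
        rw [Nat.succ_mul] at h₃
        omega
    rw [hac] at he
    exact ⟨hκ hac, hκ (by omega)⟩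
  set S : V → V → Set ℕ := fun u v => {n | ∃ a b, SimPair E (u, v) (a, b) ∧ n = κ a * M + κ b}
  have hS : ∀ u v, sInf (S u v) ∈ S u v := fun u v => Nat.sInf_mem ⟨_, u, v, .refl, rfl⟩
  have hle : ∀ u v a b, SimPair E (u, v) (a, b) → sInf (S u v) ≤ κ a * M + κ b :=
    fun u v a b hab => Nat.sInf_le ⟨a, b, hab, rfl⟩
  have hcongr : ∀ u v u' v', SimPair E (u, v) (u', v') → S u v = S u' v' := by
    intro u v u' v' hs
    ext n
    exact ⟨fun ⟨a, b, hab, hn⟩ => ⟨a, b, (hs.symm hE).trans hab, hn⟩,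
      fun ⟨a, b, hab, hn⟩ => ⟨a, b, hs.trans hab, hn⟩⟩
  refine ⟨fun u v => sInf (S u v) < sInf (S v u), ?_, fun u v => lt_asymm, ?_, ?_, ?_⟩
  · intro u v u' v' hs ht
    have hs' : SimPair E (v, u) (v', u') := hs.swap
    simpa only [hcongr _ _ _ _ hs, hcongr _ _ _ _ hs'] using ht
  · intro u v huv
    refine lt_or_gt_of_ne fun he => h ⟨u, v, huv, ?_⟩
    obtain ⟨a, b, hab, h₁⟩ := hS u v
    obtain ⟨c, d, hcd, h₂⟩ := hS v u
    obtain ⟨rfl, rfl⟩ := hinj a b c d (by omega)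
    exact hab.trans (hcd.symm hE)
  · intro u v ht
    obtain ⟨a, b, hab, h₁⟩ := hS u v
    have h₂ := hle v u v u .refl
    exact ⟨a, b, hab, hlt a b v u (by omega)⟩
  · intro u v huv ht
    obtain ⟨a, b, hab, h₁⟩ := hS u v
    have he := hab.eq_of_subset fun w => (huv w).1
    obtain ⟨rfl, rfl⟩ := Prod.mk.inj he
    have h₂ := hle b a b a .refl
    refine lt_of_le_of_ne (hlt a b b a (by omega)) fun he => ?_
    obtain rfl := hκ he
    exact lt_irrefl _ ht

end Classes

section Acyclic

variable {V : Type*} {E T : V → V → Prop}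

/-- `T` is an asymmetric union of classes of `SimPair E`. -/
structure ClassOrientation (E T : V → V → Prop) : Prop where
  closed : ∀ {u v u' v'}, SimPair E (u, v) (u', v') → T u v → T u' v'
  asymm : ∀ {u v}, T u v → ¬ T v u

theorem ClassOrientation.forces (hT : ClassOrientation E T) {u v u' v' : V} (h₁ : E u u')
    (h₂ : E v v') (h₃ : ¬ E u v') (h₄ : ¬ E v u') (h : T u v) : T u' v' :=
  hT.closed (.single (Or.inr ⟨h₁, h₂, h₃, h₄⟩)) h

theorem ClassOrientation.compat (hE : ∀ ⦃u v⦄, E u v → E v u) (hT : ClassOrientation E T) : Compat E T T :=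
  ⟨fun h => hE h, hT.forces, hT.forces, hT.asymm, hT.asymm⟩

theorem ClassOrientation.compat_compl (hE : ∀ ⦃u v⦄, E u v → E v u) (hT : ClassOrientation E T) :
    Compat (fun u v => ¬ E u v) T (fun u v => T v u) :=
  ⟨fun h e => h (hE e),
    fun h₁ h₂ h₃ h₄ h => hT.forces (not_not.1 h₃) (not_not.1 h₄) h₁ h₂ h,
    fun h₁ h₂ h₃ h₄ h => hT.forces (not_not.1 h₄) (not_not.1 h₃) h₂ h₁ h,
    hT.asymm, hT.asymm⟩

/-- Some triangle of `E` or of its complement starts with `x`. -/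
def StartsTriangle (E T : V → V → Prop) (x : V) : Prop :=
  ∃ y z x' y' z', Triangle E T x y z x' y' z' ∨
    Triangle (fun u v => ¬ E u v) T x y z x' y' z'

variable {x y z x' y' z' : V}

theorem startsTriangle_of_incomparable (hE : ∀ ⦃u v⦄, E u v → E v u) (hT : ClassOrientation E T)
    (hxy : T x y) (hyz : T y z) (hzx : T z x)
    (h₁ : ∃ w, E x w ∧ ¬ E y w) (h₂ : ∃ w, E y w ∧ ¬ E x w)
    (h₃ : ∃ w, E y w ∧ ¬ E z w) (h₄ : ∃ w, E z w ∧ ¬ E y w) : StartsTriangle E T x := by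
  obtain ⟨a, ha, ha'⟩ := h₁
  obtain ⟨b, hb, hb'⟩ := h₂
  obtain ⟨c, hc, hc'⟩ := h₃
  obtain ⟨d, hd, hd'⟩ := h₄
  have hs : ∀ {u v}, E u v → E v u := fun h => hE h
  have hn : ∀ {u v}, ¬ E u v → ¬ E v u := fun h e => h (hE e)
  by_cases hza : E z a <;> by_cases hzb : E z b
  · have hxc : E x c := by
      by_contra hxc
      exact hT.asymm hyz (hT.forces (hs hza) (hs hc) (hn ha') (hn hc')
        (hT.forces ha hc hxc ha' hxy))
    exact ⟨y, z, b, a, c, Or.inr ⟨hb', ha', hc', not_not.2 ha, not_not.2 hxc, not_not.2 hb,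
      not_not.2 hc, not_not.2 hzb, not_not.2 hza, hxy, hyz, hzx⟩⟩
  · exact absurd (hT.forces (hs hza) (hs hb) (hn ha') (hn hzb) (hT.forces ha hb hb' ha' hxy))
      (hT.asymm hyz)
  · exact absurd (hT.forces (hs ha) (hs hzb) (hn hza) (hn hb') (hT.forces ha hb hb' ha' hxy))
      (hT.asymm hzx)
  · have hxd : ¬ E x d := fun hxd =>
      hT.asymm hyz (hT.forces (hs hd) (hs hb) (hn hd') (hn hzb)
        (hT.forces hxd hb hb' hd' hxy))
    exact ⟨y, z, a, b, d, Or.inl ⟨ha, hb, hd, hb', hxd, ha', hd', hza, hzb, hxy, hyz, hzx⟩⟩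

theorem moved_of_simPair (hE : ∀ ⦃u v⦄, E u v → E v u) (hT : ClassOrientation E T)
    (t : Triangle E T x y z x' y' z') {r : V × V} (hr : SimPair E (z, x) r) :
    Moved E T y z y' z' r.1 r.2 ∨ Moved E T y' z' y z r.1 r.2 := by
  have hC := hT.compat hE
  induction hr with
  | refl => exact Or.inl ⟨⟨_, _, t⟩, _, t⟩
  | tail _ h ih =>
    rcases h with rfl | ⟨h₁, h₂, h₃, h₄⟩
    · exact ih
    · rcases ih with ih | ih
      · exact Or.inr (ih.step hC h₁ h₂ h₃ h₄)
      · exact Or.inl (ih.step hC h₁ h₂ h₃ h₄)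

theorem moved_of_simPair_compl (hE : ∀ ⦃u v⦄, E u v → E v u) (hT : ClassOrientation E T)
    (t : Triangle (fun u v => ¬ E u v) T x y z x' y' z') {r : V × V}
    (hr : SimPair E (z, x) r) :
    (Moved (fun u v => ¬ E u v) T y z y' z' r.1 r.2 ∧
      AvoidWalk (fun u v => ¬ E u v) (commonNbrs (fun u v => ¬ E u v) y z y' z')
        (x, false) (r.2, false)) ∨
    (Moved (fun u v => ¬ E u v) (fun u v => T v u) y' z' y z r.2 r.1 ∧
      AvoidWalk (fun u v => ¬ E u v) (commonNbrs (fun u v => ¬ E u v) y z y' z')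
        (x, false) (r.1, true)) := by
  have hC := hT.compat_compl hE
  induction hr with
  | refl => exact Or.inl ⟨⟨⟨_, _, t⟩, _, t⟩, .refl⟩
  | @tail p q _ h ih =>
    rcases h with rfl | ⟨h₁, h₂, h₃, h₄⟩
    · exact ih
    · rcases ih with ⟨ih, w⟩ | ⟨ih, w⟩
      · have hm := ih.step hC h₃ h₄ (not_not.2 h₁) (not_not.2 h₂)
        obtain ⟨c, tc⟩ := ih.2
        obtain ⟨d, td⟩ := hm.2
        exact Or.inr ⟨hm, w.tail ⟨h₄, fun e => tc.xy e.2.2.1, fun e => td.xy e.1, rfl⟩⟩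
      · have hm := ih.step hC.flip h₄ h₃ (not_not.2 h₂) (not_not.2 h₁)
        obtain ⟨c, tc⟩ := ih.2
        obtain ⟨d, td⟩ := hm.2
        exact Or.inl ⟨hm, w.tail ⟨h₃, fun e => tc.xy e.1, fun e => td.xy e.2.2.1, rfl⟩⟩

theorem startsTriangle_of_simPair (hE : ∀ ⦃u v⦄, E u v → E v u) (hT : ClassOrientation E T)
    (t : Triangle E T x y z x' y' z' ∨ Triangle (fun u v => ¬ E u v) T x y z x' y' z')
    {a b : V} (hr : SimPair E (z, x) (a, b)) : StartsTriangle E T a := by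
  rcases t with t | t
  · rcases moved_of_simPair hE hT t hr with ⟨⟨p, q, s⟩, -⟩ | ⟨⟨p, q, s⟩, -⟩
    · exact ⟨_, _, _, _, _, Or.inl s.rotate.rotate⟩
    · exact ⟨_, _, _, _, _, Or.inl s.rotate.rotate⟩
  · rcases moved_of_simPair_compl hE hT t hr with ⟨⟨⟨p, q, s⟩, -⟩, -⟩ | ⟨⟨⟨p, q, s⟩, -⟩, -⟩
    · exact ⟨_, _, _, _, _, Or.inr s.rotate.rotate⟩
    · exact ⟨b, y', q, p, y, Or.inr ⟨s.xx, s.zz, s.yy, s.xz, s.xy, s.zx, s.zy, s.yx, s.yz,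
        s.tzx, s.tyz, s.txy⟩⟩

theorem Triangle.not_simPair (hE : ∀ ⦃u v⦄, E u v → E v u) (hrefl : ∀ v, E v v)
    (hT : ClassOrientation E T) (t : Triangle E T x y z x' y' z') (b : V) :
    ¬ SimPair E (z, x) (x, b) := by
  have hC := hT.compat hE
  have hs : ∀ {u v}, E u v → E v u := fun h => hE h
  intro hr
  by_cases hxy : E x y
  · rcases moved_of_simPair hE hT t hr with ⟨⟨p, q, s⟩, -⟩ | ⟨⟨p, q, s⟩, -⟩
    · exact hT.asymm t.txy s.tyz
    · exact s.zy hxy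
  · have hxz : ¬ E x z := fun e => hxy (t.rotate.rotate.column_full hC e (hrefl x))
    have hyz : ¬ E y z := fun e => hxy (hs (t.rotate.column_full hC (hrefl y) e))
    have t' : Triangle E T x y z x y z :=
      ⟨hrefl x, hrefl y, hrefl z, hxy, hxz, fun e => hxy (hs e), hyz, fun e => hxz (hs e),
        fun e => hyz (hs e), t.txy, t.tyz, t.tzx⟩
    rcases moved_of_simPair hE hT t' hr with ⟨⟨p, q, s⟩, -⟩ | ⟨⟨p, q, s⟩, -⟩
    · exact hT.asymm t.txy s.tyz
    · exact hT.asymm t.txy s.tyz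

theorem Triangle.coreRank_lt [Finite V] (hE : ∀ ⦃u v⦄, E u v → E v u) (hrefl : ∀ v, E v v)
    (hT : ClassOrientation E T) (t : Triangle (fun u v => ¬ E u v) T x y z x' y' z') {b : V}
    (hr : SimPair E (z, x) (x, b)) :
    coreRank (fun u v => ¬ E u v) x < coreRank (fun u v => ¬ E u v) z := by
  have hC := hT.compat_compl hE
  rcases moved_of_simPair_compl hE hT t hr with ⟨⟨⟨p, q, s⟩, -⟩, -⟩ | ⟨⟨-, p, s⟩, w⟩
  · exact absurd s.tyz (hT.asymm t.txy)
  · have s' := s.flip hC.flip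
    have hirr : ∀ v, ¬ ¬ E v v := fun v => not_not.2 (hrefl v)
    exact (isOddCore_of_triangles hC hirr hT.asymm t s' w).coreRank_lt hC.symm
      (fun e => t.zy e.2.2.1) (not_odd_third hC hirr hT.asymm t s')

/-- The class orientation given by a vertex order compatible with `coreRank` has no triangle. -/
theorem not_startsTriangle [Finite V] (hE : ∀ ⦃u v⦄, E u v → E v u) (hrefl : ∀ v, E v v)
    (hT : ClassOrientation E T) {κ : V → ℕ} (hκ : Function.Injective κ)
    (hrank : ∀ a b, coreRank (fun u v => ¬ E u v) a < coreRank (fun u v => ¬ E u v) b →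
      κ b < κ a)
    (hlex : ∀ u v, T u v → ∃ a b, SimPair E (u, v) (a, b) ∧ κ a ≤ κ v) (v : V) :
    ¬ StartsTriangle E T v := by
  intro hv
  obtain ⟨x, hx, hmin⟩ := (Set.toFinite {v | StartsTriangle E T v}).exists_minimalFor κ _ ⟨v, hv⟩
  have hmin : ∀ a, StartsTriangle E T a → κ x ≤ κ a := fun a ha =>
    (le_total (κ x) (κ a)).elim id (hmin ha)
  obtain ⟨y, z, x', y', z', t⟩ := hx
  have hzx : T z x := t.elim (fun t => t.tzx) fun t => t.tzx
  obtain ⟨a, b, hab, hle⟩ := hlex z x hzx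
  obtain rfl := hκ (le_antisymm hle (hmin a (startsTriangle_of_simPair hE hT t hab)))
  rcases t with t | t
  · exact t.not_simPair hE hrefl hT b hab
  · exact (hrank _ _ (t.coreRank_lt hE hrefl hT hab)).not_ge
      (hmin z ⟨_, _, _, _, _, Or.inr t.rotate.rotate⟩)

end Acyclic

section Ordering

variable {V : Type*} {E T : V → V → Prop}

/-- Order by inclusion of neighbourhoods, and by `T` if that does not decide. -/
def inclusionThen (E T : V → V → Prop) (u v : V) : Prop :=
  ((∀ w, E u w → E v w) ∧ ∃ w, E v w ∧ ¬ E u w) ∨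
    (((∀ w, E u w ↔ E v w) ∨ ((∃ w, E u w ∧ ¬ E v w) ∧ ∃ w, E v w ∧ ¬ E u w)) ∧ T u v)

theorem inclusionThen_asymm (hT : ∀ {u v}, T u v → ¬ T v u) {u v : V}
    (h : inclusionThen E T u v) : ¬ inclusionThen E T v u := by
  rintro (⟨h₁, w, hw, hw'⟩ | ⟨h₁, h₂⟩)
  · rcases h with ⟨h₃, -⟩ | ⟨h₃ | ⟨-, a, ha, ha'⟩, -⟩
    · exact hw' (h₃ w hw)
    · exact hw' ((h₃ w).1 hw)
    · exact ha' (h₁ a ha)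
  · rcases h with ⟨h₃, w, hw, hw'⟩ | ⟨-, h₃⟩
    · rcases h₁ with h₁ | ⟨-, a, ha, ha'⟩
      · exact hw' ((h₁ w).1 hw)
      · exact ha' (h₃ a ha)
    · exact hT h₂ h₃

theorem inclusionThen_total (hT : ∀ u v, u ≠ v → T u v ∨ T v u) {u v : V} (huv : u ≠ v) :
    inclusionThen E T u v ∨ inclusionThen E T v u := by
  by_cases h₁ : ∀ w, E u w → E v w <;> by_cases h₂ : ∀ w, E v w → E u w
  · exact (hT u v huv).imp (fun h => Or.inr ⟨Or.inl fun w => ⟨h₁ w, h₂ w⟩, h⟩)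
      fun h => Or.inr ⟨Or.inl fun w => ⟨h₂ w, h₁ w⟩, h⟩
  · push Not at h₂
    exact Or.inl (Or.inl ⟨h₁, h₂⟩)
  · push Not at h₁
    exact Or.inr (Or.inl ⟨h₂, h₁⟩)
  · push Not at h₁ h₂
    exact (hT u v huv).imp (fun h => Or.inr ⟨Or.inr ⟨h₁, h₂⟩, h⟩)
      fun h => Or.inr ⟨Or.inr ⟨h₂, h₁⟩, h⟩

theorem inclusionThen_cases {u v : V} (h : inclusionThen E T u v) :
    (∀ w, E u w → E v w) ∨
      ((∃ w, E u w ∧ ¬ E v w) ∧ (∃ w, E v w ∧ ¬ E u w) ∧ T u v) := by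
  rcases h with h | ⟨h | h, ht⟩
  · exact Or.inl h.1
  · exact Or.inl fun w => (h w).1
  · exact Or.inr ⟨h.1, h.2, ht⟩

/-- No cyclic triple has nested neighbourhoods in two consecutive places, provided that `T`
follows a common order on twins. -/
theorem inclusionThen_not_cyclic_of_subset (hE : ∀ ⦃u v⦄, E u v → E v u) (hT : ClassOrientation E T)
    {κ : V → ℕ} (htwin : ∀ u v, (∀ w, E u w ↔ E v w) → T u v → κ u < κ v) {x y z : V}
    (hxy : inclusionThen E T x y) (hyz : inclusionThen E T y z) (hzx : inclusionThen E T z x)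
    (hsub : ∀ w, E x w → E y w) : False := by
  have twin : ∀ {u v}, inclusionThen E T u v → (∀ w, E u w ↔ E v w) → κ u < κ v := by
    rintro u v (⟨-, w, hw, hw'⟩ | h) he
    · exact absurd ((he w).2 hw) hw'
    · exact htwin u v he h.2
  rcases inclusionThen_cases hyz with h₁ | ⟨⟨a, ha, ha'⟩, ⟨b, hb, hb'⟩, ht⟩ <;>
    rcases inclusionThen_cases hzx with h₂ | ⟨⟨c, hc, hc'⟩, ⟨d, hd, hd'⟩, ht'⟩
  · have h₃ := twin hxy fun w => ⟨hsub w, fun e => h₂ w (h₁ w e)⟩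
    have h₄ := twin hyz fun w => ⟨h₁ w, fun e => hsub w (h₂ w e)⟩
    have h₅ := twin hzx fun w => ⟨h₂ w, fun e => h₁ w (hsub w e)⟩
    omega
  · exact hd' (h₁ d (hsub d hd))
  · exact hb' (hsub b (h₂ b hb))
  · have hn : ∀ {u v}, ¬ E u v → ¬ E v u := fun h e => h (hE e)
    have h₃ : T d b := hT.forces (hsub d hd) hb hb' hd' ht
    exact hT.asymm ht' (hT.forces (hE hd) (hE hb) (hn hd')
      (fun e => hb' (hsub b (hE e))) h₃)

theorem inclusionThen_trans (hE : ∀ ⦃u v⦄, E u v → E v u) (hT : ClassOrientation E T)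
    (htotal : ∀ u v, u ≠ v → T u v ∨ T v u) {κ : V → ℕ}
    (htwin : ∀ u v, (∀ w, E u w ↔ E v w) → T u v → κ u < κ v)
    (htri : ∀ v, ¬ StartsTriangle E T v) {x y z : V}
    (hxy : inclusionThen E T x y) (hyz : inclusionThen E T y z) : inclusionThen E T x z := by
  by_contra hxz
  have hzx : inclusionThen E T z x := by
    refine (inclusionThen_total htotal ?_).resolve_left hxz
    rintro rfl
    exact inclusionThen_asymm hT.asymm hxy hyz
  rcases inclusionThen_cases hxy with h₁ | ⟨h₁, h₁', t₁⟩
  · exact inclusionThen_not_cyclic_of_subset hE hT htwin hxy hyz hzx h₁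
  rcases inclusionThen_cases hyz with h₂ | ⟨h₂, h₂', t₂⟩
  · exact inclusionThen_not_cyclic_of_subset hE hT htwin hyz hzx hxy h₂
  rcases inclusionThen_cases hzx with h₃ | ⟨-, -, t₃⟩
  · exact inclusionThen_not_cyclic_of_subset hE hT htwin hzx hxy hyz h₃
  exact htri x (startsTriangle_of_incomparable hE hT t₁ t₂ t₃ h₁ h₁' h₂ h₂')

theorem inclusionThen_isSCOrdering (hE : ∀ ⦃u v⦄, E u v → E v u) (hT : ClassOrientation E T) :
    IsSCOrdering E (inclusionThen E T) := by
  rintro u v x y huv hxy ⟨h₁, h₂, h₃, h₄⟩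
  have t₁ : T u v := by
    rcases inclusionThen_cases huv with h | ⟨-, -, h⟩
    · exact absurd (h y h₂) h₄
    · exact h
  have t₂ : T x y := by
    rcases inclusionThen_cases hxy with h | ⟨-, -, h⟩
    · exact absurd (hE (h v (hE h₃))) h₄
    · exact h
  exact hT.asymm t₂ (hT.forces h₂ h₃ h₁ h₄ t₁)

end Ordering

/-- If a reflexive graph contains no invertible pair, then it is a strong
cocomparability graph. -/
theorem stmt7 {V : Type*} [Fintype V] (E : V → V → Prop)
    (hsymm : Symmetric E) (hrefl : Reflexive E)
    (h : ¬ ∃ u v : V, u ≠ v ∧ SimPair E (u, v) (v, u)) :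
    IsStrongCocompGraph E := by
  obtain ⟨κ, hκ, hrank⟩ := exists_key fun u v => ¬ E u v
  obtain ⟨T, hclosed, hasymm, htotal, hlex, htwin⟩ := exists_orientation hsymm h hκ
  have hT : ClassOrientation E T := ⟨hclosed _ _ _ _, hasymm _ _⟩
  have htri := not_startsTriangle hsymm hrefl hT hκ hrank hlex
  refine ⟨inclusionThen E T, ?_, inclusionThen_isSCOrdering hsymm hT⟩
  exact
    { trichotomous := fun u v h₁ h₂ => by
        by_contra huv
        exact (inclusionThen_total htotal huv).elim h₁ h₂
      irrefl := fun u hu => inclusionThen_asymm hT.asymm hu hu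
      trans := fun u v w => inclusionThen_trans hsymm hT htotal htwin htri }
end

section
/- The following statements are equivalent for a reflexive graph G: (i) G is a strong cocomparability graph; (ii) G contains no invertible pair; (iii) the auxiliary graph G⁺ is bipartite. -/
/-- Adjacency in the auxiliary graph `G⁺`. -/
def AuxAdj {V : Type*} (E : V → V → Prop)
    (p q : {r : V × V // r.1 ≠ r.2}) : Prop :=
  Forces E p.1 (q.1.2, q.1.1)

/-- The irreflexive part of `Forces`: the edges `ac`, `bd` are present and `ad`, `bc` are absent. -/
def Crosses {V : Type*} (E : V → V → Prop) (a b c d : V) : Prop :=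
  E a c ∧ E b d ∧ ¬ E a d ∧ ¬ E b c

/-- Two vertices whose neighbourhoods are incomparable. -/
def Conflict {V : Type*} (E : V → V → Prop) (a b : V) : Prop :=
  ∃ c d, Crosses E a b c d

/-- The pairs `(a, b)` and `(c, d)` are joined by a walk of even length in `Crosses`. -/
def EvenSim {V : Type*} (E : V → V → Prop) (a b c d : V) : Prop :=
  Relation.ReflTransGen
    (fun p q : V × V => ∃ r s, Crosses E p.1 p.2 r s ∧ Crosses E r s q.1 q.2) (a, b) (c, d)

/-- A transitive orientation of the conflict graph that is closed under `EvenSim`. -/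
structure IsEvenOrientation {V : Type*} (E : V → V → Prop) (O : V → V → Prop) : Prop where
  conflict : ∀ {a b}, O a b → Conflict E a b
  total : ∀ {a b}, Conflict E a b → O a b ∨ O b a
  asymm : ∀ {a b}, O a b → ¬ O b a
  closed : ∀ {a b c d}, O a b → EvenSim E a b c d → O c d
  acyclic : ∀ {a b c}, O a b → O b c → ¬ O c a

/-- A pair on which `O` and the orientation it induces across `Crosses` differ. -/
def Discordant {V : Type*} (E : V → V → Prop) (O : V → V → Prop) (a b : V) : Prop :=
  O a b ∧ ∀ c d, Crosses E a b c d → O d c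

section

variable {V : Type*} {E : V → V → Prop} {O : V → V → Prop} {a b c d p q r s : V}

lemma Crosses.swap (h : Crosses E a b c d) : Crosses E b a d c :=
  ⟨h.2.1, h.1, h.2.2.2, h.2.2.1⟩

lemma Crosses.symm (hs : Symmetric E) (h : Crosses E a b c d) : Crosses E c d a b :=
  ⟨hs h.1, hs h.2.1, fun k => h.2.2.2 (hs k), fun k => h.2.2.1 (hs k)⟩

lemma Crosses.conflict (h : Crosses E a b c d) : Conflict E a b := ⟨c, d, h⟩

lemma Crosses.conflict_right (hs : Symmetric E) (h : Crosses E a b c d) : Conflict E c d :=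
  (h.symm hs).conflict

lemma Crosses.forces (h : Crosses E a b c d) : Forces E (a, b) (c, d) := Or.inr h

lemma Conflict.symm (h : Conflict E a b) : Conflict E b a :=
  let ⟨_, _, h⟩ := h; h.swap.conflict

lemma Conflict.ne (h : Conflict E a b) : a ≠ b := by
  rintro rfl
  obtain ⟨c, d, h⟩ := h
  exact h.2.2.2 h.1

lemma Conflict.exists_left (h : Conflict E a b) : ∃ c, E a c ∧ ¬ E b c :=
  let ⟨c, _, h⟩ := h; ⟨c, h.1, h.2.2.2⟩

lemma EvenSim.refl : EvenSim E a b a b := Relation.ReflTransGen.refl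

lemma EvenSim.trans (h : EvenSim E a b c d) (k : EvenSim E c d p q) : EvenSim E a b p q :=
  Relation.ReflTransGen.trans h k

lemma Crosses.evenSim (h : Crosses E a b r s) (k : Crosses E r s c d) : EvenSim E a b c d :=
  Relation.ReflTransGen.single ⟨r, s, h, k⟩

lemma EvenSim.induction {P : V → V → Prop} (h : EvenSim E a b c d) (base : P a b)
    (step : ∀ {x y r s z w}, EvenSim E a b x y → P x y → Crosses E x y r s → Crosses E r s z w →
      P z w) : P c d := by
  have key : ∀ p : V × V, Relation.ReflTransGen
      (fun p q : V × V => ∃ r s, Crosses E p.1 p.2 r s ∧ Crosses E r s q.1 q.2) (a, b) p →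
      P p.1 p.2 := by
    intro p hp
    induction hp with
    | refl => exact base
    | tail h₁ h₂ ih =>
      obtain ⟨r, s, h₂, h₃⟩ := h₂
      exact step h₁ ih h₂ h₃
  exact key (c, d) h

lemma EvenSim.swap (h : EvenSim E a b c d) : EvenSim E b a d c :=
  h.induction (P := fun x y => EvenSim E b a y x) .refl
    fun _ ih h₁ h₂ => ih.trans (h₁.swap.evenSim h₂.swap)

lemma EvenSim.symm (hs : Symmetric E) (h : EvenSim E a b c d) : EvenSim E c d a b :=
  h.induction (P := fun x y => EvenSim E x y a b) .refl
    fun _ ih h₁ h₂ => ((h₂.symm hs).evenSim (h₁.symm hs)).trans ih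

lemma EvenSim.conflict (hs : Symmetric E) (h : EvenSim E a b c d) (k : Conflict E a b) :
    Conflict E c d :=
  h.induction (P := Conflict E) k fun _ _ _ h₂ => h₂.conflict_right hs

lemma EvenSim.simPair (h : EvenSim E a b c d) : SimPair E (a, b) (c, d) :=
  h.induction (P := fun x y => SimPair E (a, b) (x, y)) .refl
    fun _ ih h₁ h₂ => (ih.tail h₁.forces).tail h₂.forces

lemma evenSim_of_common (hs : Symmetric E) (h : Crosses E a b r s) (k : Crosses E c d r s) :
    EvenSim E a b c d := h.evenSim (k.symm hs)

/-- If `b` has a private neighbour and `a` has none, then `(a, b)` and `(c, b)` are equivalent. -/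
lemma evenSim_of_private (hs : Symmetric E) (hab : Conflict E a b) (hb : E b r) (har : ¬ E a r)
    (hcr : ¬ E c r) (ha : ∀ x, E a x → ¬ E b x → E c x) : EvenSim E a b c b := by
  obtain ⟨x, hax, hbx⟩ := hab.exists_left
  exact evenSim_of_common hs (r := x) (s := r) ⟨hax, hb, har, hbx⟩ ⟨ha x hax hbx, hb, hcr, hbx⟩

/-- Three pairwise conflicting vertices whose pairs are inequivalent at `b` and `c` either all have
private neighbours, or the neighbours of `b` and of `c` are shared. -/
lemma private_or_shared (hs : Symmetric E) (hab : Conflict E a b) (hbc : Conflict E b c)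
    (h₁ : ¬ EvenSim E a b c b) (h₂ : ¬ EvenSim E a c b c) :
    (∃ x y z, (E a x ∧ ¬ E b x ∧ ¬ E c x) ∧ (E b y ∧ ¬ E a y ∧ ¬ E c y) ∧
      (E c z ∧ ¬ E a z ∧ ¬ E b z)) ∨
    ((∀ x, E b x → E a x ∨ E c x) ∧ ∀ x, E c x → E a x ∨ E b x) := by
  by_cases hb : ∃ y, E b y ∧ ¬ E a y ∧ ¬ E c y
  · left
    obtain ⟨y, hy⟩ := hb
    by_cases ha : ∃ x, E a x ∧ ¬ E b x ∧ ¬ E c x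
    · by_cases hc : ∃ z, E c z ∧ ¬ E a z ∧ ¬ E b z
      · obtain ⟨x, hx⟩ := ha
        obtain ⟨z, hz⟩ := hc
        exact ⟨x, y, z, hx, hy, hz⟩
      · exact absurd ((evenSim_of_private hs hbc.symm hy.1 hy.2.2 hy.2.1 (by grind)).symm hs) h₁
    · exact absurd (evenSim_of_private hs hab hy.1 hy.2.1 hy.2.2 (by grind)) h₁
  · right
    refine ⟨by grind, ?_⟩
    by_contra hc
    push Not at hc
    obtain ⟨z, hz⟩ := hc
    exact h₂ ((evenSim_of_private hs hbc hz.1 hz.2.2 hz.2.1 (by grind)).symm hs)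

lemma evenSim_apex_step (hs : Symmetric E) (hab : Conflict E a b)
    (h₁ : ¬ EvenSim E a b c b) (h₂ : ¬ EvenSim E a c b c)
    (hr : Crosses E b c p q) (hp : Crosses E p q r s) :
    EvenSim E a b a r ∧ EvenSim E a c a s := by
  have hr' := hr
  have hp' := hp
  obtain ⟨hbp, hcq, hbq, hcp⟩ := hr'
  obtain ⟨hpr, hqs, hps, hqr⟩ := hp'
  rcases private_or_shared hs hab hr.conflict h₁ h₂ with
    ⟨x, y, z, ⟨hax, hbx, hcx⟩, ⟨hby, hay, hcy⟩, ⟨hcz, haz, hbz⟩⟩ | ⟨hb, hc⟩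
  · have hap : ¬ E a p := fun hap => h₂ (evenSim_of_common hs (r := p) (s := z)
      ⟨hap, hcz, haz, hcp⟩ ⟨hbp, hcz, hbz, hcp⟩)
    have haq : ¬ E a q := fun haq => h₁ (evenSim_of_common hs (r := q) (s := y)
      ⟨haq, hby, hay, hbq⟩ ⟨hcq, hby, hcy, hbq⟩)
    have hab' : Crosses E a b x p := ⟨hax, hbp, hap, hbx⟩
    have hac' : Crosses E a c x q := ⟨hax, hcq, haq, hcx⟩
    have hxr : ¬ E x r := fun hxr => h₂ <|
      (hac'.evenSim (c := r) (d := c) ⟨hxr, hs hcq, fun k => hcx (hs k), hqr⟩).trans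
        (evenSim_of_common hs (r := p) (s := q) ⟨hs hpr, hcq, fun k => hqr (hs k), hcp⟩ hr)
    have hxs : ¬ E x s := fun hxs => h₁ <|
      (hab'.evenSim (c := s) (d := b) ⟨hxs, hs hbp, fun k => hbx (hs k), hps⟩).trans
        (evenSim_of_common hs (r := q) (s := p) ⟨hs hqs, hbp, fun k => hps (hs k), hbq⟩ hr.swap)
    exact ⟨hab'.evenSim ⟨hs hax, hpr, hxr, fun k => hap (hs k)⟩,
      hac'.evenSim ⟨hs hax, hqs, hxs, fun k => haq (hs k)⟩⟩
  · obtain ⟨x, hbx, hax⟩ := hab.symm.exists_left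
    have hcx : E c x := (hb x hbx).resolve_left hax
    have hap : E a p := (hb p hbp).resolve_right hcp
    have haq : E a q := (hc q hcq).resolve_right hbq
    have hab' : Crosses E a b q x := ⟨haq, hbx, hax, hbq⟩
    have hac' : Crosses E a c p x := ⟨hap, hcx, hax, hcp⟩
    have hxr : E x r := by
      by_contra hxr
      exact h₂ <| (hac'.evenSim (c := r) (d := c) ⟨hpr, hs hcx, fun k => hcp (hs k), hxr⟩).trans
        (evenSim_of_common hs (r := p) (s := q) ⟨hs hpr, hcq, fun k => hqr (hs k), hcp⟩ hr)
    have hxs : E x s := by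
      by_contra hxs
      exact h₁ <| (hab'.evenSim (c := s) (d := b) ⟨hqs, hs hbx, fun k => hbq (hs k), hxs⟩).trans
        (evenSim_of_common hs (r := q) (s := p) ⟨hs hqs, hbp, fun k => hps (hs k), hbq⟩ hr.swap)
    exact ⟨hab'.evenSim ⟨hs haq, hxr, hqr, fun k => hax (hs k)⟩,
      hac'.evenSim ⟨hs hap, hxs, hps, fun k => hax (hs k)⟩⟩

/-- The analogue of the triangle lemma for implication classes of comparability graphs. -/
lemma evenSim_apex (hs : Symmetric E) (hab : Conflict E a b)
    (h₁ : ¬ EvenSim E a b c b) (h₂ : ¬ EvenSim E a c b c) (h : EvenSim E b c r s) :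
    EvenSim E a b a r ∧ EvenSim E a c a s :=
  h.induction (P := fun r s => EvenSim E a b a r ∧ EvenSim E a c a s) ⟨.refl, .refl⟩ <| by
    rintro x y p q z w hxy ⟨hx, hy⟩ hr hp
    have := evenSim_apex_step hs (hx.conflict hs hab)
      (fun k => h₁ ((hx.trans k).trans (hxy.symm hs).swap))
      (fun k => h₂ ((hy.trans k).trans (hxy.symm hs))) hr hp
    exact ⟨hx.trans this.1, hy.trans this.2⟩

namespace IsEvenOrientation

lemma apex (hs : Symmetric E) (hO : IsEvenOrientation E O) (hab : O a b) (hbc : O b c)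
    (hne : ¬ EvenSim E a c b c) (h : EvenSim E b c r s) :
    EvenSim E a b a r ∧ EvenSim E a c a s :=
  evenSim_apex hs (hO.conflict hab) (fun k => hO.asymm hbc (hO.closed hab k)) hne h

lemma trans (hs : Symmetric E) (hO : IsEvenOrientation E O) (hab : O a b) (hbc : O b c) :
    O a c := by
  have hne : ¬ EvenSim E a b c b := fun k => hO.asymm hbc (hO.closed hab k)
  suffices hac : Conflict E a c from (hO.total hac).resolve_right (hO.acyclic hab hbc)
  obtain ⟨x, y, hxa, hyb, hya, hxb⟩ := hO.conflict hab
  obtain ⟨u, v, hub, hvc, hvb, huc⟩ := hO.conflict hbc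
  by_contra hac
  have key : (∀ x, E a x → E c x) ∨ ∀ x, E c x → E a x := by
    by_contra hk
    push Not at hk
    obtain ⟨⟨z, hz⟩, w, hw⟩ := hk
    exact hac ⟨z, w, hz.1, hw.1, hw.2, hz.2⟩
  rcases key with key | key
  · exact hne (evenSim_of_common hs (r := x) (s := u)
      ⟨hxa, hub, fun k => huc (key _ k), hxb⟩ ⟨key _ hxa, hub, huc, hxb⟩)
  · exact hne (evenSim_of_common hs (r := v) (s := y)
      ⟨key _ hvc, hyb, hya, hvb⟩ ⟨hvc, hyb, fun k => hya (key _ k), hvb⟩)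

end IsEvenOrientation

/-- Orient every class so that its lexicographically least pair is increasing. -/
lemma exists_isEvenOrientation [Finite V] (hs : Symmetric E)
    (hinv : ∀ a b, Conflict E a b → ¬ EvenSim E a b b a) : ∃ O, IsEvenOrientation E O := by
  classical
  obtain ⟨n, ⟨e⟩⟩ := Finite.exists_equiv_fin V
  let _ : LinearOrder V := LinearOrder.lift' e e.injective
  let S : V → V → Set (V ×ₗ V) := fun a b =>
    {x | (ofLex x).1 < (ofLex x).2 ∧
      (EvenSim E a b (ofLex x).1 (ofLex x).2 ∨ EvenSim E a b (ofLex x).2 (ofLex x).1)}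
  let O : V → V → Prop := fun a b => Conflict E a b ∧
    ∃ x y, x < y ∧ EvenSim E a b x y ∧ ∀ z ∈ S a b, toLex (x, y) ≤ z
  have hS : ∀ {a b c d}, EvenSim E a b c d → S a b = S c d := fun h => by
    ext x
    exact and_congr_right fun _ => or_congr ⟨(h.symm hs).trans, h.trans⟩ ⟨(h.symm hs).trans, h.trans⟩
  have hSswap : ∀ a b, S a b = S b a := fun a b => by
    ext x
    exact and_congr_right fun _ => ⟨fun h => (h.imp .swap .swap).symm,
      fun h => (h.imp .swap .swap).symm⟩
  have closed : ∀ {a b c d}, O a b → EvenSim E a b c d → O c d := by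
    rintro a b c d ⟨hab, x, y, hxy, h, hmin⟩ k
    exact ⟨k.conflict hs hab, x, y, hxy, (k.symm hs).trans h, hS k ▸ hmin⟩
  have mem : ∀ {a b x y}, EvenSim E a b x y → x < y → toLex (x, y) ∈ S a b :=
    fun h hxy => ⟨hxy, Or.inl h⟩
  have mem' : ∀ {a b x y}, EvenSim E a b x y → y < x → toLex (y, x) ∈ S a b :=
    fun h hxy => ⟨hxy, Or.inr h⟩
  have asymm : ∀ {a b}, O a b → ¬ O b a := by
    rintro a b ⟨hab, x, y, hxy, h, hmin⟩ ⟨-, z, w, hzw, k, hmin'⟩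
    have h₁ := hmin (toLex (z, w)) (hSswap b a ▸ mem k hzw)
    have h₂ := hmin' (toLex (x, y)) (hSswap a b ▸ mem h hxy)
    obtain ⟨rfl, rfl⟩ := Prod.mk.inj (toLex.injective (le_antisymm h₁ h₂))
    exact hinv a b hab (h.trans (k.symm hs))
  have total : ∀ {a b}, Conflict E a b → O a b ∨ O b a := by
    intro a b hab
    have hne : (S a b).Nonempty := by
      rcases lt_or_gt_of_ne hab.ne with h | h
      · exact ⟨_, mem .refl h⟩
      · exact ⟨_, mem' .refl h⟩
    have : Finite (V ×ₗ V) := inferInstanceAs (Finite (V × V))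
    obtain ⟨m, hm, hmin⟩ := Set.exists_min_image (S a b) id (Set.toFinite _) hne
    obtain ⟨hlt, h | h⟩ := hm
    · exact Or.inl ⟨hab, _, _, hlt, h, hmin⟩
    · exact Or.inr ⟨hab.symm, _, _, hlt, h.swap, hSswap a b ▸ hmin⟩
  have apex : ∀ {a b c r s}, O a b → O b c → O c a → EvenSim E b c r s →
      EvenSim E a b a r ∧ EvenSim E a c a s := fun hab hbc hca h =>
    evenSim_apex hs hab.1 (fun k => asymm hbc (closed hab k))
      (fun k => asymm hca (closed hbc (k.symm hs))) h
  have key : ∀ {a b c}, O a b → O b c → O c a → ∀ x y, EvenSim E b c x y → x < y →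
      (∀ z ∈ S a b, toLex (x, y) ≤ z) → False := by
    intro a b c hab hbc hca x y h hxy hmin
    obtain ⟨h₁, h₂⟩ := apex hab hbc hca h
    rw [hS h₁] at hmin
    replace hab := closed hab h₁
    replace hbc := closed hbc h
    replace hca := closed hca h₂.swap
    have hxa : x < a := by
      rcases lt_or_gt_of_ne hab.1.ne with k | k
      · have := hmin _ (mem .refl k)
        rw [Prod.Lex.toLex_le_toLex] at this
        grind
      · exact k
    obtain ⟨z, w, hzw, hz, hzmin⟩ := hab.2
    have h₃ := hmin _ (mem hz hzw)
    have h₄ := hzmin _ (mem' .refl hxa)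
    rw [Prod.Lex.toLex_le_toLex] at h₃ h₄
    obtain rfl : z = x := by grind
    exact asymm hbc (closed hca (apex hca hab hbc hz).1)
  refine ⟨O, fun h => h.1, total, asymm, closed, ?_⟩
  intro a b c hab hbc hca
  obtain ⟨x₁, y₁, hlt₁, h₁, hmin₁⟩ := hab.2
  obtain ⟨x₂, y₂, hlt₂, h₂, hmin₂⟩ := hbc.2
  obtain ⟨x₃, y₃, hlt₃, h₃, hmin₃⟩ := hca.2
  rcases le_total (toLex (x₁, y₁)) (toLex (x₂, y₂)) with h | h
  · rcases le_total (toLex (x₁, y₁)) (toLex (x₃, y₃)) with k | k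
    · exact key hca hab hbc x₁ y₁ h₁ hlt₁ fun z hz => k.trans (hmin₃ z hz)
    · exact key hbc hca hab x₃ y₃ h₃ hlt₃ fun z hz => (k.trans h).trans (hmin₂ z hz)
  · rcases le_total (toLex (x₂, y₂)) (toLex (x₃, y₃)) with k | k
    · exact key hab hbc hca x₂ y₂ h₂ hlt₂ fun z hz => h.trans (hmin₁ z hz)
    · exact key hbc hca hab x₃ y₃ h₃ hlt₃ fun z hz => k.trans (hmin₂ z hz)

namespace IsEvenOrientation

lemma discordant_of_crosses (hs : Symmetric E) (hO : IsEvenOrientation E O) (hab : O a b)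
    (h : Crosses E a b c d) (hdc : O d c) : Discordant E O a b :=
  ⟨hab, fun _ _ k => hO.closed hdc ((h.symm hs).swap.evenSim k.swap)⟩

lemma of_not_discordant (hs : Symmetric E) (hO : IsEvenOrientation E O) (hab : O a b)
    (hd : ¬ Discordant E O a b) (h : Crosses E a b c d) : O c d :=
  (hO.total (h.conflict_right hs)).resolve_right
    fun k => hd (hO.discordant_of_crosses hs hab h k)

lemma discordant_congr (hs : Symmetric E) (hO : IsEvenOrientation E O) (hd : Discordant E O a b)
    (h : EvenSim E a b c d) : Discordant E O c d :=
  h.induction hd fun _ ih h₁ h₂ => hO.discordant_of_crosses hs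
    (hO.closed ih.1 (h₁.evenSim h₂)) (h₂.symm hs) (ih.2 _ _ h₁)

lemma discordant_left_or_right (hs : Symmetric E) (hO : IsEvenOrientation E O)
    (hac : Discordant E O a c) (hab : O a b) (hbc : O b c) :
    Discordant E O a b ∨ Discordant E O b c := by
  by_contra hd
  push Not at hd
  obtain ⟨hd₁, hd₂⟩ := hd
  have h₁ : ¬ EvenSim E a b c b := fun k => hO.asymm hbc (hO.closed hab k)
  have h₂ : ¬ EvenSim E a c b c := fun k => hd₂ (hO.discordant_congr hs hac k)
  have h₃ : ¬ EvenSim E b a c a := fun k => hd₁ (hO.discordant_congr hs hac (k.symm hs).swap)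
  have cab := hO.conflict hab
  have cbc := hO.conflict hbc
  have cac := hO.conflict hac.1
  rcases private_or_shared hs cab cbc h₁ h₂ with
    ⟨x, y, z, ⟨hax, hbx, hcx⟩, ⟨hby, hay, hcy⟩, ⟨hcz, haz, hbz⟩⟩ | ⟨hb, hc⟩
  · exact hO.acyclic (hO.of_not_discordant hs hab hd₁ ⟨hax, hby, hay, hbx⟩)
      (hO.of_not_discordant hs hbc hd₂ ⟨hby, hcz, hbz, hcy⟩) (hac.2 _ _ ⟨hax, hcz, haz, hcx⟩)
  · obtain ⟨x, hbx, hcx⟩ := cbc.exists_left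
    obtain ⟨y, hcy, hby⟩ := cbc.symm.exists_left
    obtain ⟨z, hbz, haz⟩ := cab.symm.exists_left
    have hax : E a x := (hb x hbx).resolve_right hcx
    have hay : E a y := (hc y hcy).resolve_right hby
    have hcz : E c z := (hb z hbz).resolve_left haz
    exact hO.acyclic (hO.of_not_discordant hs hbc hd₂ ⟨hbx, hcy, hby, hcx⟩)
      (hO.of_not_discordant hs hab hd₁ ⟨hay, hbz, haz, hby⟩) (hac.2 _ _ ⟨hax, hcz, haz, hcx⟩)

/-- Some discordant pair has no vertex between its ends. -/
lemma exists_discordant_covering [Finite V] (hs : Symmetric E) (hO : IsEvenOrientation E O)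
    (h : Discordant E O a c) :
    ∃ a c, Discordant E O a c ∧ ∀ b, O a b → ¬ O b c := by
  induction hn : {b | O a b ∧ O b c}.ncard using Nat.strong_induction_on generalizing a c with
  | _ n ih =>
    by_cases hb : ∃ b, O a b ∧ O b c
    · obtain ⟨b, hab, hbc⟩ := hb
      subst hn
      rcases hO.discordant_left_or_right hs h hab hbc with hd | hd
      · refine ih _ ?_ hd rfl
        refine Set.ncard_lt_ncard ?_ (Set.toFinite _)
        refine (Set.ssubset_iff_of_subset ?_).2 ⟨b, ⟨hab, hbc⟩, fun k => (hO.asymm k.2) k.2⟩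
        exact fun x hx => ⟨hx.1, hO.trans hs hx.2 hbc⟩
      · refine ih _ ?_ hd rfl
        refine Set.ncard_lt_ncard ?_ (Set.toFinite _)
        refine (Set.ssubset_iff_of_subset ?_).2 ⟨b, ⟨hab, hbc⟩, fun k => (hO.asymm k.1) k.1⟩
        exact fun x hx => ⟨hO.trans hs hab hx.1, hx.2⟩
    · push Not at hb
      exact ⟨a, c, h, hb⟩

/-- Reversing the class of a pair with no vertex between its ends keeps the orientation valid. -/
lemma flip (hs : Symmetric E) (hO : IsEvenOrientation E O) (hac : O a c)
    (hcov : ∀ b, O a b → ¬ O b c) :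
    IsEvenOrientation E fun u v => (O u v ∧ ¬ EvenSim E a c u v) ∨ EvenSim E a c v u := by
  have sub : ∀ {u v}, EvenSim E a c u v → O u v := hO.closed hac
  have trans' : ∀ {u v w}, EvenSim E a c u v → EvenSim E a c v w → EvenSim E a c u w := by
    intro u v w huv hvw
    by_contra huw
    exact (hO.conflict (hO.closed (sub huv) (hO.apex hs (sub huv) (sub hvw)
      (fun k => huw (hvw.trans (k.symm hs))) ((hvw.symm hs).trans huv)).1)).ne rfl
  have between : ∀ {u v w}, O u v → ¬ EvenSim E a c u v → O v w → ¬ EvenSim E a c v w →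
      ¬ EvenSim E a c u w := by
    intro u v w huv huv' hvw hvw' huw
    have h := evenSim_apex hs (a := v) (b := u) (c := w) (hO.conflict huv).symm
      (fun k => huv' (huw.trans (k.symm hs).swap))
      (fun k => hvw' (huw.trans (k.symm hs))) (huw.symm hs)
    exact hcov v (hO.closed huv h.1.swap) (hO.closed hvw h.2)
  constructor
  · rintro u v (h | h)
    · exact hO.conflict h.1
    · exact (hO.conflict (sub h)).symm
  · intro u v h
    rcases hO.total h with k | k <;> grind
  · rintro u v (h | h) (k | k)
    · exact hO.asymm h.1 k.1
    · exact h.2 k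
    · exact k.2 h
    · exact hO.asymm (sub h) (sub k)
  · rintro u v x y (h | h) k
    · exact Or.inl ⟨hO.closed h.1 k, fun l => h.2 (l.trans (k.symm hs))⟩
    · exact Or.inr (h.trans k.swap)
  · rintro u v w (huv | huv) (hvw | hvw) (hwu | hwu)
    · exact hO.acyclic huv.1 hvw.1 hwu.1
    · exact between huv.1 huv.2 hvw.1 hvw.2 hwu
    · exact between hwu.1 hwu.2 huv.1 huv.2 hvw
    · exact huv.2 (trans' hwu hvw)
    · exact between hvw.1 hvw.2 hwu.1 hwu.2 huv
    · exact hvw.2 (trans' huv hwu)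
    · exact hwu.2 (trans' hvw huv)
    · exact hO.acyclic (sub hvw) (sub huv) (sub hwu)

end IsEvenOrientation

lemma exists_concordant [Finite V] (hs : Symmetric E)
    (hinv : ∀ a b, a ≠ b → ¬ SimPair E (a, b) (b, a)) :
    ∃ O, IsEvenOrientation E O ∧ ∀ a b, ¬ Discordant E O a b := by
  obtain ⟨O, hO⟩ := exists_isEvenOrientation hs fun a b h k => hinv a b h.ne k.simPair
  induction hn : {x : V × V | Discordant E O x.1 x.2}.ncard
    using Nat.strong_induction_on generalizing O with
  | _ n ih =>
    by_cases hd : ∃ a b, Discordant E O a b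
    · obtain ⟨a₀, c₀, h₀⟩ := hd
      obtain ⟨a, c, hac, hcov⟩ := hO.exists_discordant_covering hs h₀
      subst hn
      refine ih _ (Set.ncard_lt_ncard ?_ (Set.toFinite _)) _ (hO.flip hs hac.1 hcov) rfl
      refine (Set.ssubset_iff_of_subset ?_).2 ⟨(a, c), hac, ?_⟩
      · rintro ⟨u, v⟩ ⟨huv, hall⟩
        simp only [Set.mem_ofPred_eq] at huv hall ⊢
        rcases huv with huv | huv
        · obtain ⟨x, y, hxy⟩ := hO.conflict huv.1
          rcases hall x y hxy with k | k
          · exact hO.discordant_of_crosses hs huv.1 hxy k.1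
          · exact absurd huv.1 (hO.asymm ((hO.discordant_congr hs hac k).2 _ _ (hxy.symm hs)))
        · have hvu := hO.discordant_congr hs hac huv
          obtain ⟨x, y, hxy⟩ := (hO.conflict hvu.1).symm
          rcases hall x y hxy with k | k
          · exact absurd k.1 (hO.asymm (hvu.2 _ _ hxy.swap))
          · exact absurd (((huv.symm hs).trans k).simPair.tail (hxy.symm hs).forces)
              (hinv v u (hO.conflict hvu.1).ne)
      · rintro ⟨h | h, -⟩
        · exact h.2 .refl
        · exact hO.asymm hac.1 (hO.closed hac.1 h)
    · push Not at hd
      exact ⟨O, hO, hd⟩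

lemma isStrongCocompGraph_of_no_invertible [Finite V] (hs : Symmetric E)
    (hinv : ∀ a b, a ≠ b → ¬ SimPair E (a, b) (b, a)) : IsStrongCocompGraph E := by
  obtain ⟨O, hO, hd⟩ := exists_concordant hs hinv
  let P : V → V → Prop := fun a b => a = b ∨ O a b
  have : IsPartialOrder V P :=
    { refl := fun _ => Or.inl rfl
      trans := by
        rintro a b c (rfl | hab) (rfl | hbc)
        · exact Or.inl rfl
        · exact Or.inr hbc
        · exact Or.inr hab
        · exact Or.inr (hO.trans hs hab hbc)
      antisymm := by
        rintro a b (rfl | hab) (h | hba)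
        · rfl
        · rfl
        · exact h.symm
        · exact absurd hba (hO.asymm hab) }
  obtain ⟨L, hL, hPL⟩ := extend_partialOrder P
  refine ⟨fun a b => L a b ∧ a ≠ b, ?_, ?_⟩
  · exact
      { trichotomous := fun a b h₁ h₂ => by
          by_contra hab
          rcases hL.total a b with h | h
          · exact h₁ ⟨h, hab⟩
          · exact h₂ ⟨h, Ne.symm hab⟩
        irrefl := fun a h => h.2 rfl
        trans := fun a b c hab hbc => ⟨hL.trans _ _ _ hab.1 hbc.1, fun h => hab.2
          (hL.antisymm _ _ hab.1 (h ▸ hbc.1))⟩ }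
  · rintro u v x y ⟨huv, huv'⟩ ⟨hxy, hxy'⟩ ⟨hux, huy, hvx, hvy⟩
    have hc : Crosses E u v y x := ⟨huy, hvx, hux, hvy⟩
    rcases hO.total hc.conflict with h | h
    · exact hxy' (hL.antisymm _ _ hxy
        (hPL _ _ (Or.inr (hO.of_not_discordant hs h (hd _ _) hc))))
    · exact huv' (hL.antisymm _ _ huv (hPL _ _ (Or.inr h)))

lemma IsSCOrdering.lt_of_forces {lt : V → V → Prop} [IsStrictTotalOrder V lt]
    (h : IsSCOrdering E lt) {p q : V × V} (hpq : Forces E p q) (hp : lt p.1 p.2) :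
    lt q.1 q.2 := by
  rcases hpq with rfl | ⟨h₁, h₂, h₃, h₄⟩
  · exact hp
  · rcases trichotomous_of lt q.1 q.2 with k | k | k
    · exact k
    · exact absurd (k ▸ h₁) h₃
    · exact absurd ⟨h₃, h₁, h₂, h₄⟩ (h _ _ _ _ hp k)

lemma Forces.ne {p q : V × V} (h : Forces E p q) (hp : p.1 ≠ p.2) : q.1 ≠ q.2 := by
  rcases h with rfl | ⟨h₁, -, h₃, -⟩
  · exact hp
  · exact fun k => h₃ (k ▸ h₁)

lemma color_eq_of_simPair {f : {r : V × V // r.1 ≠ r.2} → Bool}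
    (hf : ∀ p q, AuxAdj E p q → f p ≠ f q) {p q : V × V} (hp : p.1 ≠ p.2) (h : SimPair E p q) :
    ∃ hq : q.1 ≠ q.2, f ⟨q, hq⟩ = f ⟨p, hp⟩ := by
  induction h with
  | refl => exact ⟨hp, rfl⟩
  | @tail q r _ h ih =>
    obtain ⟨hq, ih⟩ := ih
    have hr := h.ne hq
    refine ⟨hr, ?_⟩
    have h₁ := hf ⟨q, hq⟩ ⟨(r.2, r.1), hr.symm⟩ h
    have h₂ := hf ⟨r, hr⟩ ⟨(r.2, r.1), hr.symm⟩ (Or.inl rfl)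
    exact (Bool.eq_not_of_ne h₂).trans ((Bool.eq_not_of_ne h₁).symm.trans ih)

end

/-- For a reflexive graph `G` the following are equivalent: (i) `G` is a
strong cocomparability graph; (ii) `G` contains no invertible pair;
(iii) the auxiliary graph `G⁺` is bipartite. -/
theorem stmt8 {V : Type*} [Fintype V] (E : V → V → Prop)
    (hsymm : Symmetric E) (hrefl : Reflexive E) :
    List.TFAE
      [ IsStrongCocompGraph E,
        ¬ ∃ u v : V, u ≠ v ∧ SimPair E (u, v) (v, u),
        ∃ c : {r : V × V // r.1 ≠ r.2} → Bool,
          ∀ p q : {r : V × V // r.1 ≠ r.2}, AuxAdj E p q → c p ≠ c q ] := by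
  classical
  tfae_have 1 → 3 := by
    rintro ⟨lt, hlt, h⟩
    refine ⟨fun p => decide (lt p.1.1 p.1.2), fun p q hpq => ?_⟩
    have hpq' : Forces E (p.1.2, p.1.1) q.1 := by
      rcases hpq with hpq | hpq
      · exact Or.inl (by rw [hpq])
      · exact Or.inr ⟨hpq.2.1, hpq.1, hpq.2.2.2, hpq.2.2.1⟩
    intro heq
    have heq' : lt p.1.1 p.1.2 ↔ lt q.1.1 q.1.2 := decide_eq_decide.1 heq
    rcases trichotomous_of lt p.1.1 p.1.2 with k | k | k
    · exact asymm_of lt (h.lt_of_forces hpq k) (heq'.1 k)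
    · exact p.2 k
    · exact asymm_of lt k (heq'.2 (h.lt_of_forces hpq' k))
  tfae_have 3 → 2 := by
    rintro ⟨f, hf⟩ ⟨u, v, huv, h⟩
    obtain ⟨hvu, heq⟩ := color_eq_of_simPair hf (p := (u, v)) huv h
    exact hf ⟨(v, u), hvu⟩ ⟨(u, v), huv⟩ (Or.inl rfl) heq
  tfae_have 2 → 1 := fun h =>
    isStrongCocompGraph_of_no_invertible hsymm fun a b hab k => h ⟨a, b, hab, k⟩
  tfae_finish
end
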